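/- Suppose p ≥ 3, ∑_{i=1}^p (d_i/d₁)^{1−j} − 2 ≤ 0, and X ∈ ℝ^p, Z ∈ ℝ^n have joint density (∏_{i=1}^p d_i^{-1/2}) σ^{-p-n} f(((x−θ)ᵀD^{-1}(x−θ) + zᵀz)/σ²). If p ≥ 4 let ν_* ∈ (0, 1−j) be the unique solution of ∑_{i=1}^{p−1} (d_i/d₁)^ν = 2 and let ν_** be any value in [0, ν_*); if p = 3 set ν_** = 0. Set c_i = (d_i/d_{p−1})^{1−j−ν_**} for i = 1,…,p−1, choose any c_p > c₁, and define u₋ = (2/(n+2))(∑_{i=1}^{p−1} (d_i/d₁)^{ν_**} − 2 + (c₁/c_p)(d_p/d₁)^{1−j}) and v₋ = min( c₁ c_{p−1}(d_{p−1} − d_p)/(c₁ d_{p−1} − c_{p−1} d_p), c_{p−1} c_p (d₁ d_{p−1} − d_p²)/(c_p d₁ d_{p−1} − c_{p−1} d_p²) ). Then any estimator θ̂_φ with φ differentiable, φ′ ≥ 0, lim_{w→∞} φ(w) ≤ u₋ and 0 ≤ φ(w)/w ≤ v₋ for all w > 0 (and with all risk expectations finite) satisfies: (a) R_j(θ̂_φ,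 θ, σ²) ≤ R_j(X, θ, σ²) for all θ ∈ ℝ^p, σ² > 0 (minimaxity under L_j), and (b) for every t = φ(w)/w, (max_i d_i(1 − t/c_i))/(min_i d_i(1 − t/c_i)) ≤ d₁/d_p (the condition number is not increased). -/

import Mathlib

open MeasureTheory Finset Filter

/-- The tail integral `∫_r^∞ f`, valued in the extended nonnegative reals. -/
noncomputable def tailIntegral (f : ℝ → ℝ) (r : ℝ) : ENNReal :=
  ∫⁻ t in Set.Ioi r, ENNReal.ofReal (f t)

lemma measurable_tailIntegral {f : ℝ → ℝ} (hf : Measurable f) :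
    Measurable (tailIntegral f) := by
  have h : tailIntegral f = fun r => ∫⁻ t,
      ({q : ℝ × ℝ | q.1 < q.2}.indicator fun q => ENNReal.ofReal (f q.2)) (r, t) := by
    funext r
    rw [tailIntegral, ← lintegral_indicator measurableSet_Ioi]
    rfl
  rw [h]
  refine Measurable.lintegral_prod_right' (Measurable.indicator ?_ ?_)
  · exact (hf.comp measurable_snd).ennreal_ofReal
  · exact measurableSet_lt measurable_fst measurable_snd

lemma setLIntegral_Ioi_mul_comp_sq {f : ℝ → ℝ} {D a s : ℝ} (hD : 0 < D) (hs : 0 ≤ s) :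
    ∫⁻ t in Set.Ioi s, ENNReal.ofReal (t * f (t ^ 2 / D + a)) =
      ENNReal.ofReal (D / 2) * tailIntegral f (s ^ 2 / D + a) := by
  have himg : (fun t : ℝ => t ^ 2 / D + a) '' Set.Ioi s = Set.Ioi (s ^ 2 / D + a) := by
    ext r
    simp only [Set.mem_image, Set.mem_Ioi]
    constructor
    · rintro ⟨t, ht, rfl⟩
      have : s ^ 2 < t ^ 2 := by nlinarith
      gcongr
    · intro hr
      have h1 : s ^ 2 < D * (r - a) := by
        have : s ^ 2 / D < r - a := by linarith
        rw [div_lt_iff₀ hD] at this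
        linarith
      refine ⟨√(D * (r - a)), Real.lt_sqrt_of_sq_lt h1, ?_⟩
      rw [Real.sq_sqrt (by nlinarith [sq_nonneg s])]
      field_simp
      ring
  have hinj : Set.InjOn (fun t : ℝ => t ^ 2 / D + a) (Set.Ioi s) := by
    intro x hx y hy hxy
    simp only [Set.mem_Ioi] at hx hy
    have h : x ^ 2 = y ^ 2 := by
      have : x ^ 2 / D = y ^ 2 / D := by simpa using hxy
      field_simp at this
      exact this
    exact (sq_eq_sq₀ (by linarith) (by linarith)).mp h
  rw [tailIntegral, ← himg, lintegral_image_eq_lintegral_abs_deriv_mul measurableSet_Ioi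
    (f' := fun t => 2 * t / D) (fun x _ => ?_) hinj, ← lintegral_const_mul' _ _ (by simp)]
  · refine setLIntegral_congr_fun measurableSet_Ioi fun t ht => ?_
    have ht0 : 0 < t := lt_of_le_of_lt hs ht
    rw [← mul_assoc, ← ENNReal.ofReal_mul (by positivity), abs_of_nonneg (by positivity),
      ← ENNReal.ofReal_mul (by positivity)]
    congr 1
    field_simp
  · refine HasDerivAt.hasDerivWithinAt ?_
    simpa using ((hasDerivAt_pow 2 x).div_const D).add_const a

lemma lintegral_eq_two_mul_Ioi_of_even {g : ℝ → ENNReal} (hg : Measurable g)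
    (heven : ∀ x, g (-x) = g x) : ∫⁻ x, g x = 2 * ∫⁻ x in Set.Ioi 0, g x := by
  have h : ∫⁻ x in Set.Iic 0, g x = ∫⁻ x in Set.Ioi 0, g x := by
    have := (Measure.measurePreserving_neg (volume : Measure ℝ)).setLIntegral_comp_preimage
      (s := Set.Iic 0) measurableSet_Iic hg
    simp only [heven, Set.neg_preimage, Set.neg_Iic, neg_zero] at this
    rw [← this]
    exact setLIntegral_congr Ioi_ae_eq_Ici.symm
  rw [← lintegral_add_compl g (measurableSet_Ioi (a := (0 : ℝ))), Set.compl_Ioi, h, two_mul]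

lemma lintegral_sq_mul_comp_sq {f : ℝ → ℝ} (hf : Measurable f) {D a : ℝ} (hD : 0 < D) :
    ∫⁻ x, ENNReal.ofReal (x ^ 2 * f (x ^ 2 / D + a)) =
      ENNReal.ofReal (D / 2) * ∫⁻ x, tailIntegral f (x ^ 2 / D + a) := by
  rw [← lintegral_const_mul' _ _ (by simp)]
  have h (x : ℝ) : ENNReal.ofReal (D / 2) * tailIntegral f (x ^ 2 / D + a) =
      ∫⁻ t, ({q : ℝ × ℝ | |q.1| < q.2}.indicator
        fun q => ENNReal.ofReal (q.2 * f (q.2 ^ 2 / D + a))) (x, t) := by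
    rw [← sq_abs x, ← setLIntegral_Ioi_mul_comp_sq hD (abs_nonneg x),
      ← lintegral_indicator measurableSet_Ioi]
    rfl
  simp only [h]
  rw [lintegral_lintegral_swap]
  · have h2 (t : ℝ) : ∫⁻ x, ({q : ℝ × ℝ | |q.1| < q.2}.indicator
        fun q => ENNReal.ofReal (q.2 * f (q.2 ^ 2 / D + a))) (x, t) =
        (Set.Ioi 0).indicator (fun t => 2 * ENNReal.ofReal (t ^ 2 * f (t ^ 2 / D + a))) t := by
      have : ∀ x, ({q : ℝ × ℝ | |q.1| < q.2}.indicator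
          fun q => ENNReal.ofReal (q.2 * f (q.2 ^ 2 / D + a))) (x, t) =
          (Set.Ioo (-t) t).indicator
            (fun _ => ENNReal.ofReal (t * f (t ^ 2 / D + a))) x := by
        intro x
        simp [Set.indicator, abs_lt]
      simp only [this]
      rw [lintegral_indicator measurableSet_Ioo, setLIntegral_const, Real.volume_Ioo]
      by_cases ht : 0 < t
      · rw [Set.indicator_of_mem (by exact ht), mul_comm, ← ENNReal.ofReal_mul (by linarith),
          show (2 : ENNReal) = ENNReal.ofReal 2 by simp, ← ENNReal.ofReal_mul (by norm_num)]
        congr 1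
        ring
      · rw [Set.indicator_of_notMem (by exact ht), ENNReal.ofReal_of_nonpos (p := t - -t)
          (by linarith), mul_zero]
    simp only [h2]
    rw [lintegral_indicator measurableSet_Ioi, lintegral_const_mul' _ _ (by simp),
      lintegral_eq_two_mul_Ioi_of_even (by fun_prop) (by simp)]
  · refine (Measurable.indicator (by fun_prop) ?_).aemeasurable
    exact measurableSet_lt (by fun_prop) (by fun_prop)

/-- One-dimensional integration by parts against a kernel `f (x ^ 2 / D + a)`, as an inequality
requiring only an integral bound on the increments of `G`. -/
lemma integral_mul_comp_sq_le {f G U : ℝ → ℝ} (hf : Measurable f) (hf0 : ∀ t, 0 ≤ f t)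
    {D a C : ℝ} (hD : 0 < D) (hU : Measurable U) (hUC : ∀ x, |U x| ≤ C)
    (hint : Integrable fun x => x ^ 2 * f (x ^ 2 / D + a))
    (hG : Integrable fun x => x * G x * f (x ^ 2 / D + a))
    (hGU : ∀ s > 0, G s - G (-s) ≤ ∫ x in -s..s, U x) :
    ∫ x, x * G x * f (x ^ 2 / D + a) ≤
      D / 2 * ∫ x, U x * (tailIntegral f (x ^ 2 / D + a)).toReal := by
  set H : ℝ → ℝ → ℝ := fun t x => ({q : ℝ × ℝ | |q.2| < q.1}.indicator
    fun q => q.1 * f (q.1 ^ 2 / D + a) * U q.2) (t, x) with hH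
  have hHx (t x : ℝ) : H t x =
      (Set.Ioo (-t) t).indicator (fun x => t * f (t ^ 2 / D + a) * U x) x := by
    simp [hH, Set.indicator, abs_lt]
  have hHt (t x : ℝ) : H t x =
      (Set.Ioi |x|).indicator (fun t => U x * (t * f (t ^ 2 / D + a))) t := by
    simp [hH, Set.indicator, mul_comm]
  have hHm : Measurable (Function.uncurry H) := by
    refine Measurable.indicator (f := fun q : ℝ × ℝ => q.1 * f (q.1 ^ 2 / D + a) * U q.2)
      (by fun_prop) ?_
    exact measurableSet_lt (by fun_prop) (by fun_prop)
  have hUint (t : ℝ) : IntegrableOn U (Set.Ioo (-t) t) :=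
    Measure.integrableOn_of_bounded (by simp) hU.aestronglyMeasurable
      (ae_of_all _ hUC)
  have hHint : Integrable (Function.uncurry H) (volume.prod volume) := by
    rw [integrable_prod_iff hHm.aestronglyMeasurable]
    constructor
    · refine ae_of_all _ fun t => ?_
      simp only [Function.uncurry_apply_pair, hHx]
      exact (integrable_indicator_iff measurableSet_Ioo).2 ((hUint t).const_mul _)
    · refine Integrable.mono' (hint.const_mul (2 * C)) ?_ (ae_of_all _ fun t => ?_)
      · exact hHm.norm.stronglyMeasurable.integral_prod_right.aestronglyMeasurable
      · rw [Real.norm_of_nonneg (integral_nonneg fun _ => norm_nonneg _)]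
        simp only [Function.uncurry_apply_pair, hHx, norm_indicator_eq_indicator_norm]
        rw [integral_indicator measurableSet_Ioo]
        by_cases ht : 0 < t
        · calc ∫ x in Set.Ioo (-t) t, ‖t * f (t ^ 2 / D + a) * U x‖
              ≤ ∫ x in Set.Ioo (-t) t, t * f (t ^ 2 / D + a) * C := by
                refine integral_mono ((hUint t).const_mul _).norm
                  (integrableOn_const (by simp)) fun x => ?_
                have h0 := mul_nonneg ht.le (hf0 (t ^ 2 / D + a))
                simp only [norm_mul, Real.norm_eq_abs, abs_of_pos ht, abs_of_nonneg (hf0 _)]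
                exact mul_le_mul_of_nonneg_left (hUC x) h0
            _ = 2 * C * (t ^ 2 * f (t ^ 2 / D + a)) := by
                rw [setIntegral_const, Real.volume_real_Ioo_of_le (by linarith)]
                simp only [smul_eq_mul]
                ring
        · rw [Set.Ioo_eq_empty (by linarith)]
          simp only [setIntegral_empty]
          have := (abs_nonneg _).trans (hUC 0)
          have := hf0 (t ^ 2 / D + a)
          positivity
  have hleft : ∫ x, x * G x * f (x ^ 2 / D + a) =
      ∫ t in Set.Ioi 0, t * f (t ^ 2 / D + a) * (G t - G (-t)) := by
    rw [← intervalIntegral.integral_Iic_add_Ioi (b := (0 : ℝ)) hG.integrableOn hG.integrableOn]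
    have := integral_comp_neg_Ioi (0 : ℝ) (fun x => x * G x * f (x ^ 2 / D + a))
    rw [neg_zero] at this
    rw [← this, ← integral_add hG.comp_neg.integrableOn hG.integrableOn]
    refine integral_congr_ae (ae_of_all _ fun t => ?_)
    simp only [even_two, Even.neg_pow]
    ring
  have hGint : IntegrableOn (fun t => t * f (t ^ 2 / D + a) * (G t - G (-t))) (Set.Ioi 0) := by
    refine (hG.comp_neg.integrableOn.add hG.integrableOn).congr (ae_of_all _ fun t => ?_)
    simp only [even_two, Even.neg_pow, Pi.add_apply]
    ring
  have hright : ∫ t, ∫ x, H t x =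
      D / 2 * ∫ x, U x * (tailIntegral f (x ^ 2 / D + a)).toReal := by
    rw [integral_integral_swap hHint, ← integral_const_mul]
    refine integral_congr_ae (ae_of_all _ fun x => ?_)
    simp only [hHt]
    rw [integral_indicator measurableSet_Ioi, integral_const_mul,
      integral_eq_lintegral_of_nonneg_ae, setLIntegral_Ioi_mul_comp_sq hD (abs_nonneg x),
      ENNReal.toReal_mul, ENNReal.toReal_ofReal (by positivity), sq_abs]
    · ring
    · filter_upwards [ae_restrict_mem measurableSet_Ioi] with t ht
      exact mul_nonneg ((abs_nonneg x).trans ht.le) (hf0 _)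
    · exact (by fun_prop : Measurable fun t => t * f (t ^ 2 / D + a)).aestronglyMeasurable
  have hmid : ∫ t, ∫ x, H t x = ∫ t in Set.Ioi 0, ∫ x, H t x := by
    rw [← integral_indicator measurableSet_Ioi]
    refine integral_congr_ae (ae_of_all _ fun t => ?_)
    by_cases ht : t ∈ Set.Ioi (0 : ℝ)
    · simp [Set.indicator_of_mem ht]
    · have ht' : t ≤ 0 := by simpa using ht
      simp only [Set.indicator_of_notMem ht, hHx]
      rw [Set.Ioo_eq_empty (by linarith)]
      simp
  rw [hleft, ← hright, hmid]
  refine setIntegral_mono_on hGint hHint.integral_prod_left.integrableOn measurableSet_Ioi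
    fun t ht => ?_
  have ht0 : (0 : ℝ) < t := ht
  simp only [hHx]
  rw [integral_indicator measurableSet_Ioo, integral_const_mul, ← integral_Ioc_eq_integral_Ioo,
    ← intervalIntegral.integral_of_le (by linarith)]
  exact mul_le_mul_of_nonneg_left (hGU t ht0) (mul_nonneg ht0.le (hf0 _))

lemma lintegral_sub_sq_mul_comp_sq {f : ℝ → ℝ} (hf : Measurable f) {D : ℝ} (hD : 0 < D)
    (a m : ℝ) :
    ∫⁻ x, ENNReal.ofReal ((x - m) ^ 2 * f ((x - m) ^ 2 / D + a)) =
      ENNReal.ofReal (D / 2) * ∫⁻ x, tailIntegral f ((x - m) ^ 2 / D + a) := by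
  rw [lintegral_sub_right_eq_self
      (fun x => ENNReal.ofReal (x ^ 2 * f (x ^ 2 / D + a))) m,
    lintegral_sub_right_eq_self (fun x => tailIntegral f (x ^ 2 / D + a)) m,
    lintegral_sq_mul_comp_sq hf hD]

lemma integral_sub_mul_comp_sq_le {f G U : ℝ → ℝ} (hf : Measurable f) (hf0 : ∀ t, 0 ≤ f t)
    {D a m C : ℝ} (hD : 0 < D) (hU : Measurable U) (hUC : ∀ x, |U x| ≤ C)
    (hint : Integrable fun x => (x - m) ^ 2 * f ((x - m) ^ 2 / D + a))
    (hG : Integrable fun x => (x - m) * G x * f ((x - m) ^ 2 / D + a))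
    (hGU : ∀ s > 0, G (m + s) - G (m - s) ≤ ∫ x in m - s..m + s, U x) :
    ∫ x, (x - m) * G x * f ((x - m) ^ 2 / D + a) ≤
      D / 2 * ∫ x, U x * (tailIntegral f ((x - m) ^ 2 / D + a)).toReal := by
  have h := integral_mul_comp_sq_le (G := fun x => G (x + m)) (U := fun x => U (x + m))
    (a := a) (C := C) hf hf0 hD (by fun_prop) (fun x => hUC _)
    (by simpa using hint.comp_add_right m) (by simpa using hG.comp_add_right m)
    (fun s hs => by
      rw [intervalIntegral.integral_comp_add_right]
      simpa [add_comm, sub_eq_add_neg] using hGU s hs)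
  rw [← integral_add_right_eq_self _ m,
    ← integral_add_right_eq_self (fun x => U x * _) m]
  simpa using h

/-- The quadratic form `∑ k, (y k - m k) ^ 2 / D k`. -/
noncomputable def diagForm {ι : Type*} [Fintype ι] (m D y : ι → ℝ) : ℝ := ∑ k, (y k - m k) ^ 2 / D k

lemma measurable_diagForm {ι : Type*} [Fintype ι] (m D : ι → ℝ) : Measurable (diagForm m D) := by
  unfold diagForm
  fun_prop

section Coordinates

variable {ι : Type*} [DecidableEq ι]

/-- Separation of the `i`-th coordinate from the others. -/
noncomputable def splitCoordinate (i : ι) : (ι → ℝ) ≃ᵐ ℝ × ({k // ¬ k = i} → ℝ) :=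
  (MeasurableEquiv.piEquivPiSubtypeProd (fun _ : ι => ℝ) (fun k => k = i)).trans
    (MeasurableEquiv.prodCongr (MeasurableEquiv.funUnique {k // k = i} ℝ)
      (MeasurableEquiv.refl _))

lemma splitCoordinate_symm_self (i : ι) (q : ℝ × ({k // ¬ k = i} → ℝ)) :
    (splitCoordinate i).symm q i = q.1 := by
  have h : splitCoordinate i ((splitCoordinate i).symm q) = q := by simp
  exact congrArg Prod.fst h

lemma splitCoordinate_symm_of_ne (i : ι) (q : ℝ × ({k // ¬ k = i} → ℝ)) (k : ι) (hk : ¬ k = i) :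
    (splitCoordinate i).symm q k = q.2 ⟨k, hk⟩ := by
  have h : splitCoordinate i ((splitCoordinate i).symm q) = q := by simp
  exact congrFun (congrArg Prod.snd h) ⟨k, hk⟩

lemma update_splitCoordinate_symm (i : ι) (q : ℝ × ({k // ¬ k = i} → ℝ)) (x : ℝ) :
    Function.update ((splitCoordinate i).symm q) i x = (splitCoordinate i).symm (x, q.2) := by
  funext k
  by_cases hk : k = i
  · subst hk
    simp [splitCoordinate_symm_self]
  · simp [hk, splitCoordinate_symm_of_ne]

variable [Fintype ι]

lemma measurePreserving_splitCoordinate (i : ι) :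
    MeasurePreserving (splitCoordinate i) volume (volume.prod volume) := by
  have h : MeasurePreserving (MeasurableEquiv.funUnique {k // k = i} ℝ)
      (@Measure.pi {k // k = i} (fun _ => ℝ) (Subtype.fintype _) _ fun _ => volume) volume := by
    rw [Subsingleton.elim (Subtype.fintype fun k => k = i) Unique.fintype]
    exact volume_preserving_funUnique {k // k = i} ℝ
  exact (h.prod (MeasurePreserving.id volume)).comp
    (volume_preserving_piEquivPiSubtypeProd (fun _ : ι => ℝ) (fun k => k = i))

lemma diagForm_splitCoordinate_symm (m D : ι → ℝ) (i : ι) (x : ℝ) (y : {k // ¬ k = i} → ℝ) :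
    diagForm m D ((splitCoordinate i).symm (x, y)) = (x - m i) ^ 2 / D i +
      ∑ k : {k // ¬ k = i}, (y k - m k) ^ 2 / D k := by
  rw [diagForm, Fintype.sum_eq_add_sum_subtype_ne _ i, splitCoordinate_symm_self]
  congr 1
  exact Finset.sum_congr rfl fun k _ => by rw [splitCoordinate_symm_of_ne i _ k k.2]

lemma lintegral_sub_sq_mul_comp_diagForm {f : ℝ → ℝ} (hf : Measurable f) (m : ι → ℝ)
    {D : ι → ℝ} (hD : ∀ k, 0 < D k) (i : ι) :
    ∫⁻ y, ENNReal.ofReal ((y i - m i) ^ 2 * f (diagForm m D y)) =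
      ENNReal.ofReal (D i / 2) * ∫⁻ y, tailIntegral f (diagForm m D y) := by
  have hq := measurable_diagForm m D
  have ht := measurable_tailIntegral hf
  have he := (measurePreserving_splitCoordinate i).symm
  rw [← he.lintegral_comp (by fun_prop), ← he.lintegral_comp (by fun_prop),
    lintegral_prod_symm _ (by fun_prop), lintegral_prod_symm _ (by fun_prop),
    ← lintegral_const_mul' _ _ (by simp)]
  simp only [diagForm_splitCoordinate_symm, splitCoordinate_symm_self,
    lintegral_sub_sq_mul_comp_sq hf (hD i)]

/-- Integration by parts in the `i`-th coordinate, as an inequality. -/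
lemma integral_sub_mul_comp_diagForm_le {f : ℝ → ℝ} (hf : Measurable f) (hf0 : ∀ t, 0 ≤ f t)
    (m : ι → ℝ) {D : ι → ℝ} (hD : ∀ k, 0 < D k) (i : ι) {G U : (ι → ℝ) → ℝ} {C : ℝ}
    (hU : Measurable U) (hUC : ∀ y, |U y| ≤ C)
    (hint : Integrable fun y => (y i - m i) ^ 2 * f (diagForm m D y))
    (htail : Integrable fun y => (tailIntegral f (diagForm m D y)).toReal)
    (hG : Integrable fun y => (y i - m i) * G y * f (diagForm m D y))
    (hGU : ∀ᵐ y : ι → ℝ, ∀ s > 0,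
      G (Function.update y i (m i + s)) - G (Function.update y i (m i - s)) ≤
        ∫ x in m i - s..m i + s, U (Function.update y i x)) :
    ∫ y, (y i - m i) * G y * f (diagForm m D y) ≤
      D i / 2 * ∫ y, U y * (tailIntegral f (diagForm m D y)).toReal := by
  have he := (measurePreserving_splitCoordinate i).symm
  have hemb := (splitCoordinate i).symm.measurableEmbedding
  have hUt : Integrable fun y => U y * (tailIntegral f (diagForm m D y)).toReal :=
    htail.bdd_mul hU.aestronglyMeasurable (ae_of_all _ hUC)
  rw [← he.integrable_comp_emb hemb] at hint hG hUt
  simp only [Function.comp_def] at hG hUt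
  rw [← he.integral_comp hemb, ← he.integral_comp hemb, integral_prod_symm _ hG,
    integral_prod_symm _ hUt, ← integral_const_mul]
  have hGU' : ∀ᵐ y : {k // ¬ k = i} → ℝ, ∀ s > 0,
      G ((splitCoordinate i).symm (m i + s, y)) - G ((splitCoordinate i).symm (m i - s, y)) ≤
        ∫ x in m i - s..m i + s, U ((splitCoordinate i).symm (x, y)) := by
    have h1 := he.quasiMeasurePreserving.ae hGU
    simp only [update_splitCoordinate_symm] at h1
    obtain ⟨x, hx⟩ := (Measure.ae_ae_of_ae_prod h1).exists
    exact hx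
  refine integral_mono_ae hG.integral_prod_right (hUt.integral_prod_right.const_mul _) ?_
  filter_upwards [hGU', hint.prod_left_ae, hG.prod_left_ae] with y h1 h2 h3
  simp only [Function.comp_apply, diagForm_splitCoordinate_symm, splitCoordinate_symm_self]
    at h2 h3 ⊢
  exact integral_sub_mul_comp_sq_le (C := C) hf hf0 (hD i)
    (hU.comp ((splitCoordinate i).symm.measurable.comp (by fun_prop))) (fun x => hUC _) h2 h3 h1

end Coordinates

lemma shrinkage_increment_le {ψ ψ' : ℝ → ℝ} (hψ : ∀ w > 0, HasDerivAt ψ (ψ' w) w)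
    (hψ' : ∀ w > 0, -(ψ w / w) ≤ ψ' w)
    {c d B S : ℝ} (hc : 0 < c) (hd : 0 < d) (hB : 0 < B) (hS : 0 < S)
    {a b : ℝ} (hab : a ≤ b) :
    -2 * ψ ((b ^ 2 / (c * d) + B) / S) * b / c - -2 * ψ ((a ^ 2 / (c * d) + B) / S) * a / c ≤
      ∫ x in a..b, -2 * (ψ ((x ^ 2 / (c * d) + B) / S) / c -
        2 * ψ ((x ^ 2 / (c * d) + B) / S) * (x ^ 2 / (c ^ 2 * d * (x ^ 2 / (c * d) + B)))) := by
  have hA (x : ℝ) : 0 < x ^ 2 / (c * d) + B := by positivity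
  have hW (x : ℝ) : 0 < (x ^ 2 / (c * d) + B) / S := div_pos (hA x) hS
  have hWder (x : ℝ) : HasDerivAt (fun x => (x ^ 2 / (c * d) + B) / S)
      (2 * x / (c * d) / S) x := by
    simpa using (((hasDerivAt_pow 2 x).div_const (c * d)).add_const B).div_const S
  have hψW (x : ℝ) : HasDerivAt (fun x => ψ ((x ^ 2 / (c * d) + B) / S))
      (ψ' ((x ^ 2 / (c * d) + B) / S) * (2 * x / (c * d) / S)) x :=
    (hψ _ (hW x)).comp x (hWder x)
  have hcont : Continuous fun x => ψ ((x ^ 2 / (c * d) + B) / S) :=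
    continuous_iff_continuousAt.2 fun x => (hψW x).continuousAt
  have hder (x : ℝ) : HasDerivAt (fun x => -2 * ψ ((x ^ 2 / (c * d) + B) / S) * x / c)
      ((-2 * (ψ' ((x ^ 2 / (c * d) + B) / S) * (2 * x / (c * d) / S)) * x +
        -2 * ψ ((x ^ 2 / (c * d) + B) / S) * 1) / c) x :=
    ((((hψW x).const_mul (-2)).mul (hasDerivAt_id x)).div_const c)
  refine intervalIntegral.sub_le_integral_of_hasDeriv_right_of_le hab
    (fun x _ => (hder x).continuousAt.continuousWithinAt)
    (fun x _ => (hder x).hasDerivWithinAt) ?_ fun x _ => ?_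
  · refine Continuous.integrableOn_Icc ?_
    have h0 (x : ℝ) : c ^ 2 * d * (x ^ 2 / (c * d) + B) ≠ 0 := by
      have := hA x
      positivity
    exact continuous_const.mul ((hcont.div_const c).sub ((continuous_const.mul hcont).mul
      (Continuous.div (by fun_prop) (by fun_prop) h0)))
  · have h1 := mul_le_mul_of_nonneg_left (hψ' _ (hW x))
      (show 0 ≤ 4 * x ^ 2 / (c ^ 2 * d * S) by positivity)
    have hA0 := (hA x).ne'
    generalize ψ' ((x ^ 2 / (c * d) + B) / S) = e at *
    generalize ψ ((x ^ 2 / (c * d) + B) / S) = g at *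
    generalize x ^ 2 / (c * d) + B = A at *
    have h2 : 4 * x ^ 2 / (c ^ 2 * d * S) * -(g / (A / S)) =
        -(4 * g * x ^ 2 / (c ^ 2 * d * A)) := by field_simp
    have h3 : (-2 * (e * (2 * x / (c * d) / S)) * x + -2 * g * 1) / c =
        -(4 * x ^ 2 / (c ^ 2 * d * S) * e) - 2 * g / c := by field_simp; ring
    have h4 : -2 * (g / c - 2 * g * (x ^ 2 / (c ^ 2 * d * A))) =
        -(2 * g / c) + 4 * g * x ^ 2 / (c ^ 2 * d * A) := by ring
    linarith

lemma residual_increment_le {ψ ψ' : ℝ → ℝ} (hψ : ∀ w > 0, HasDerivAt ψ (ψ' w) w)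
    (hψ' : ∀ w > 0, -(ψ w / w) ≤ ψ' w)
    (hψ0 : ∀ w, 0 ≤ ψ w) {A B Q K : ℝ} (hA : 0 < A) (hB : 0 ≤ B)
    (hQ : 0 ≤ Q) (hm : Measurable ψ)
    (hK : ∀ z : ℝ, |ψ (A / (z ^ 2 + B)) ^ 2 * Q / (z ^ 2 + B)| ≤ K) {s : ℝ} (hs : 0 < s) :
    s * (ψ (A / (s ^ 2 + B)) ^ 2 * Q / (s ^ 2 + B)) -
        -s * (ψ (A / ((-s) ^ 2 + B)) ^ 2 * Q / ((-s) ^ 2 + B)) ≤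
      ∫ z in -s..s, (ψ (A / (z ^ 2 + B)) ^ 2 * Q / (z ^ 2 + B) +
        2 * (z ^ 2 / (z ^ 2 + B)) * (ψ (A / (z ^ 2 + B)) ^ 2 * Q / (z ^ 2 + B))) := by
  set P : ℝ → ℝ := fun z => ψ (A / (z ^ 2 + B)) ^ 2 * Q / (z ^ 2 + B) with hP
  set V : ℝ → ℝ := fun z => P z + 2 * (z ^ 2 / (z ^ 2 + B)) * P z with hV
  have hPm : Measurable P := by fun_prop
  have hVm : Measurable V := by fun_prop
  have hVK (z : ℝ) : ‖V z‖ ≤ 3 * K := by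
    have h1 : 0 ≤ z ^ 2 / (z ^ 2 + B) := by positivity
    have h2 : z ^ 2 / (z ^ 2 + B) ≤ 1 := div_le_one_of_le₀ (by linarith) (by positivity)
    have h3 : |P z| ≤ K := hK z
    calc ‖V z‖ = (1 + 2 * (z ^ 2 / (z ^ 2 + B))) * |P z| := by
          rw [hV, Real.norm_eq_abs, ← abs_of_nonneg (show 0 ≤ 1 + 2 * (z ^ 2 / (z ^ 2 + B)) by
            positivity), ← abs_mul]
          congr 1
          ring
      _ ≤ 3 * K := by
          have := abs_nonneg (P z)
          nlinarith
  have hVint (a b : ℝ) : IntegrableOn V (Set.Icc a b) :=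
    Measure.integrableOn_of_bounded (by simp) hVm.aestronglyMeasurable (ae_of_all _ hVK)
  have heven : ∀ z, V (-z) = V z := by simp [hV, hP]
  have hsplit : ∫ z in -s..s, V z = 2 * ∫ z in 0..s, V z := by
    have hII (a b : ℝ) : IntervalIntegrable V volume a b := by
      rw [intervalIntegrable_iff]
      exact (hVint _ _).mono_set Set.Ioc_subset_Icc_self
    rw [← intervalIntegral.integral_add_adjacent_intervals (hII (-s) 0) (hII 0 s)]
    have := intervalIntegral.integral_comp_neg (a := 0) (b := s) V
    simp only [heven, neg_zero] at this
    rw [← this, two_mul]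
  have hder (z : ℝ) (hz : 0 < z) : HasDerivAt (fun z => z * P z)
      (1 * P z + z * (((2 * ψ (A / (z ^ 2 + B)) ^ 1 * (ψ' (A / (z ^ 2 + B)) *
        ((0 * (z ^ 2 + B) - A * (2 * z)) / (z ^ 2 + B) ^ 2)) * Q) * (z ^ 2 + B) -
        ψ (A / (z ^ 2 + B)) ^ 2 * Q * (2 * z)) / (z ^ 2 + B) ^ 2)) z := by
    have hS : 0 < z ^ 2 + B := by positivity
    have hSd : HasDerivAt (fun z : ℝ => z ^ 2 + B) (2 * z) z := by
      simpa using (hasDerivAt_pow 2 z).add_const B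
    have h1 : HasDerivAt (fun z : ℝ => ψ (A / (z ^ 2 + B))) (ψ' (A / (z ^ 2 + B)) *
        ((0 * (z ^ 2 + B) - A * (2 * z)) / (z ^ 2 + B) ^ 2)) z :=
      (hψ _ (div_pos hA hS)).comp z ((hasDerivAt_const z A).div hSd hS.ne')
    have h2 := (((h1.pow 2).mul_const Q).div hSd hS.ne')
    exact (hasDerivAt_id z).mul h2
  have hmain : s * P s - 0 * P 0 ≤ ∫ z in 0..s, V z := by
    refine intervalIntegral.sub_le_integral_of_hasDeriv_right_of_le
      (g := fun z => z * P z) hs.le (fun z hz => ?_)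
      (fun z hz => (hder z hz.1).hasDerivWithinAt) (hVint _ _) fun z hz => ?_
    · rcases hz.1.eq_or_lt with h | h
      · subst h
        refine ContinuousAt.continuousWithinAt ?_
        rw [ContinuousAt, zero_mul]
        refine squeeze_zero_norm (a := fun z => |z| * K) (fun z => ?_) ?_
        · rw [norm_mul]
          exact mul_le_mul_of_nonneg_left (hK z) (abs_nonneg z)
        · have : Continuous fun z : ℝ => |z| * K := by fun_prop
          simpa using this.tendsto 0
      · exact (hder z h).continuousAt.continuousWithinAt
    · have hz0 : 0 < z := hz.1
      have hS : 0 < z ^ 2 + B := by positivity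
      have h1 := hψ' _ (div_pos hA hS)
      have hg := hψ0 (A / (z ^ 2 + B))
      simp only [hV, hP]
      generalize ψ' (A / (z ^ 2 + B)) = e at *
      generalize ψ (A / (z ^ 2 + B)) = g at *
      generalize z ^ 2 + B = S at *
      have h2 := mul_le_mul_of_nonneg_left h1
        (show 0 ≤ 4 * z ^ 2 * g * A * Q / S ^ 3 by positivity)
      have h3 : 4 * z ^ 2 * g * A * Q / S ^ 3 * -(g / (A / S)) =
          -(4 * z ^ 2 * g ^ 2 * Q / S ^ 2) := by field_simp
      have h4 : 1 * (g ^ 2 * Q / S) + z * (((2 * g ^ 1 * (e *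
          ((0 * S - A * (2 * z)) / S ^ 2)) * Q) * S - g ^ 2 * Q * (2 * z)) / S ^ 2) =
          g ^ 2 * Q / S - 4 * z ^ 2 * g * A * Q / S ^ 3 * e -
            2 * z ^ 2 * g ^ 2 * Q / S ^ 2 := by field_simp; ring
      have h5 : g ^ 2 * Q / S + 2 * (z ^ 2 / S) * (g ^ 2 * Q / S) =
          g ^ 2 * Q / S + 2 * z ^ 2 * g ^ 2 * Q / S ^ 2 := by field_simp
      have h6 : 4 * z ^ 2 * g ^ 2 * Q / S ^ 2 = 2 * (2 * z ^ 2 * g ^ 2 * Q / S ^ 2) := by ring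
      linarith
  have hPe : P (-s) = P s := by simp [hP]
  change s * P s - -s * P (-s) ≤ ∫ z in -s..s, V z
  rw [hsplit, hPe]
  linarith

section Risk

variable {α β : Type*}

/-- The weighted square `∑ i, x i ^ 2 / (c i * d i)` of the location part. -/
noncomputable def weightedSq [Fintype α] (c d : α → ℝ) (y : α ⊕ β → ℝ) : ℝ :=
  ∑ i, y (Sum.inl i) ^ 2 / (c i * d i)

/-- The residual sum of squares `∑ k, z k ^ 2`. -/
noncomputable def residualSq (α : Type*) {β : Type*} [Fintype β] (y : α ⊕ β → ℝ) : ℝ :=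
  ∑ k, y (Sum.inr k) ^ 2

/-- The squared length `∑ i, x i ^ 2 / c i ^ 2` of the shrinkage direction. -/
noncomputable def directionSq [Fintype α] (c : α → ℝ) (y : α ⊕ β → ℝ) : ℝ :=
  ∑ i, y (Sum.inl i) ^ 2 / c i ^ 2

lemma measurable_weightedSq [Fintype α] (c d : α → ℝ) : Measurable (weightedSq (β := β) c d) := by
  unfold weightedSq
  fun_prop

lemma measurable_residualSq [Fintype β] : Measurable (residualSq α (β := β)) := by
  unfold residualSq
  fun_prop

lemma measurable_directionSq [Fintype α] (c : α → ℝ) : Measurable (directionSq (β := β) c) := by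
  unfold directionSq
  fun_prop

lemma weightedSq_nonneg [Fintype α] {c d : α → ℝ} (hc : ∀ i, 0 < c i) (hd : ∀ i, 0 < d i)
    (y : α ⊕ β → ℝ) : 0 ≤ weightedSq c d y :=
  sum_nonneg fun i _ => by have := hc i; have := hd i; positivity

lemma residualSq_nonneg [Fintype β] (y : α ⊕ β → ℝ) : 0 ≤ residualSq α y :=
  sum_nonneg fun _ _ => sq_nonneg _

lemma directionSq_nonneg [Fintype α] (c : α → ℝ) (y : α ⊕ β → ℝ) : 0 ≤ directionSq c y :=
  sum_nonneg fun _ _ => by positivity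

lemma directionSq_le [Fintype α] {c d : α → ℝ} {M : ℝ} (hc : ∀ i, 0 < c i) (hd : ∀ i, 0 < d i)
    (hM : ∀ i, d i / c i ≤ M) (y : α ⊕ β → ℝ) : directionSq c y ≤ M * weightedSq c d y := by
  rw [directionSq, weightedSq, mul_sum]
  refine sum_le_sum fun i _ => ?_
  have h1 := hc i
  have h2 := hd i
  calc y (Sum.inl i) ^ 2 / c i ^ 2 = d i / c i * (y (Sum.inl i) ^ 2 / (c i * d i)) := by
        field_simp
    _ ≤ M * (y (Sum.inl i) ^ 2 / (c i * d i)) := by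
        gcongr
        exact hM i

lemma weightedSq_update_inl [Fintype α] [DecidableEq α] [DecidableEq β]
    (c d : α → ℝ) (y : α ⊕ β → ℝ) (i : α) (x : ℝ) :
    weightedSq c d (Function.update y (Sum.inl i) x) = x ^ 2 / (c i * d i) +
      ∑ k ∈ univ.erase i, y (Sum.inl k) ^ 2 / (c k * d k) := by
  rw [weightedSq, ← add_sum_erase _ _ (mem_univ i)]
  congr 1
  · simp
  · refine sum_congr rfl fun k hk => ?_
    rw [Function.update_of_ne (by simpa using ne_of_mem_erase hk)]

lemma residualSq_update_inr [Fintype β] [DecidableEq α] [DecidableEq β]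
    (y : α ⊕ β → ℝ) (i : β) (x : ℝ) :
    residualSq α (Function.update y (Sum.inr i) x) = x ^ 2 +
      ∑ k ∈ univ.erase i, y (Sum.inr k) ^ 2 := by
  rw [residualSq, ← add_sum_erase _ _ (mem_univ i)]
  congr 1
  · simp
  · refine sum_congr rfl fun k hk => ?_
    rw [Function.update_of_ne (by simpa using ne_of_mem_erase hk)]

lemma residualSq_update_inl [Fintype β] [DecidableEq α] [DecidableEq β]
    (y : α ⊕ β → ℝ) (i : α) (x : ℝ) :
    residualSq α (Function.update y (Sum.inl i) x) = residualSq α y := by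
  simp [residualSq]

lemma weightedSq_update_inr [Fintype α] [DecidableEq α] [DecidableEq β]
    (c d : α → ℝ) (y : α ⊕ β → ℝ) (i : β) (x : ℝ) :
    weightedSq c d (Function.update y (Sum.inr i) x) = weightedSq c d y := by
  simp [weightedSq]

lemma directionSq_update_inr [Fintype α] [DecidableEq α] [DecidableEq β]
    (c : α → ℝ) (y : α ⊕ β → ℝ) (i : β) (x : ℝ) :
    directionSq c (Function.update y (Sum.inr i) x) = directionSq c y := by
  simp [directionSq]

/-- The risk of a shrinkage estimator with a bounded factor `ψ`, for which `w * ψ w` is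
nondecreasing and bounded, does not exceed the risk of the unshrunk estimator. -/
theorem integral_shrinkage_loss_le [Fintype α] [Fintype β] [Nontrivial α] [Nonempty β]
    {c d : α → ℝ} {M L v : ℝ}
    (hc : ∀ i, 0 < c i) (hd : ∀ i, 0 < d i) (hM : ∀ i, d i / c i ≤ M)
    {ψ ψ' : ℝ → ℝ} (hψ : ∀ w > 0, HasDerivAt ψ (ψ' w) w)
    (hψ' : ∀ w > 0, -(ψ w / w) ≤ ψ' w) (hψm : Measurable ψ) (hψ0 : ∀ w, 0 ≤ ψ w)
    (hψv : ∀ w, ψ w ≤ v) (hψL : ∀ w, w * ψ w ≤ L)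
    (hL : M * (4 + (Fintype.card β + 2) * L) ≤ 2 * ∑ i, d i / c i)
    {f : ℝ → ℝ} (hf : Measurable f) (hf0 : ∀ t, 0 ≤ f t) (θ : α → ℝ) {σ : ℝ} (hσ : 0 < σ)
    {R : (α ⊕ β → ℝ) → ℝ}
    (hR : R = diagForm (Sum.elim θ 0) (Sum.elim (fun i => σ ^ 2 * d i) fun _ => σ ^ 2))
    (hf1 : Integrable fun y => f (R y))
    (hf2 : Integrable fun y => (∑ i, (y (Sum.inl i) - θ i) ^ 2) * f (R y)) :
    ∫ y, (∑ i, ((1 - ψ (weightedSq c d y / residualSq α y) / c i) * y (Sum.inl i) - θ i) ^ 2) *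
        f (R y) ≤
      ∫ y, (∑ i, (y (Sum.inl i) - θ i) ^ 2) * f (R y) := by
  classical
  set m : α ⊕ β → ℝ := Sum.elim θ 0 with hm
  set D : α ⊕ β → ℝ := Sum.elim (fun i => σ ^ 2 * d i) fun _ => σ ^ 2 with hDdef
  have hD : ∀ k, 0 < D k := by
    rintro (i | k)
    · exact mul_pos (by positivity) (hd i)
    · simp only [hDdef, Sum.elim_inr]
      positivity
  have hRm : Measurable R := hR ▸ measurable_diagForm m D
  set A := weightedSq (β := β) c d
  set S := residualSq α (β := β)
  set Q := directionSq (β := β) c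
  have hAm : Measurable A := measurable_weightedSq c d
  have hSm : Measurable S := measurable_residualSq
  have hQm : Measurable Q := measurable_directionSq c
  have hA0 : ∀ y, 0 ≤ A y := weightedSq_nonneg hc hd
  have hS0 : ∀ y, 0 ≤ S y := residualSq_nonneg
  have hQ0 : ∀ y, 0 ≤ Q y := directionSq_nonneg c
  have hQA : ∀ y, Q y ≤ M * A y := directionSq_le hc hd hM
  have hv0 : 0 ≤ v := (hψ0 0).trans (hψv 0)
  have hM0 : 0 ≤ M := by
    obtain ⟨i⟩ := (inferInstance : Nonempty α)
    exact (div_pos (hd i) (hc i)).le.trans (hM i)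
  have hL0 : 0 ≤ L := by simpa using hψL 0
  set g : (α ⊕ β → ℝ) → ℝ := fun y => ψ (A y / S y) with hg
  have hgm : Measurable g := by fun_prop
  set P : (α ⊕ β → ℝ) → ℝ := fun y => g y ^ 2 * Q y / S y with hP
  have hPm : Measurable P := by fun_prop
  have hP0 (y) : 0 ≤ P y := div_nonneg (mul_nonneg (sq_nonneg _) (hQ0 y)) (hS0 y)
  have hPK (y) : P y ≤ v * (M * L) := by
    calc P y = g y * (g y * Q y / S y) := by simp only [hP]; ring
      _ ≤ g y * (g y * (M * A y) / S y) := by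
          have := hψ0 (A y / S y)
          have := hS0 y
          have := hQA y
          simp only [hg]
          gcongr
      _ = g y * (M * (A y / S y * g y)) := by ring
      _ ≤ v * (M * L) := by
          have h1 := hψL (A y / S y)
          have h2 := hψv (A y / S y)
          have h3 := hψ0 (A y / S y)
          have h4 := div_nonneg (hA0 y) (hS0 y)
          simp only [hg]
          gcongr
  have hxA (i : α) (y) : y (Sum.inl i) ^ 2 / (c i * d i) ≤ A y :=
    single_le_sum (f := fun i => y (Sum.inl i) ^ 2 / (c i * d i))
      (fun k _ => by have := hc k; have := hd k; positivity) (mem_univ i)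
  have hzS (k : β) (y) : y (Sum.inr k) ^ 2 ≤ S y :=
    single_le_sum (f := fun k => y (Sum.inr k) ^ 2) (fun k _ => by positivity) (mem_univ k)
  have hne : ∀ᵐ y : α ⊕ β → ℝ, ∀ k, y k ≠ 0 :=
    ae_all_iff.2 fun k => Measure.ae_eval_ne (fun _ => volume) k 0
  -- integrability
  have hX2 (i : α) : Integrable fun y => (y (Sum.inl i) - m (Sum.inl i)) ^ 2 * f (R y) := by
    refine hf2.mono' (by fun_prop) (ae_of_all _ fun y => ?_)
    rw [Real.norm_of_nonneg (mul_nonneg (sq_nonneg _) (hf0 _))]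
    refine mul_le_mul_of_nonneg_right ?_ (hf0 _)
    exact single_le_sum (f := fun i => (y (Sum.inl i) - θ i) ^ 2)
      (fun k _ => by positivity) (mem_univ i)
  have htop : ∫⁻ y, tailIntegral f (R y) ≠ ⊤ := by
    obtain ⟨i⟩ := (inferInstance : Nonempty α)
    have h1 := (lintegral_ofReal_ne_top_iff_integrable (hX2 i).aestronglyMeasurable
      (ae_of_all _ fun y => mul_nonneg (sq_nonneg _) (hf0 _))).2 (hX2 i)
    rw [hR, lintegral_sub_sq_mul_comp_diagForm hf m hD] at h1
    intro h2
    rw [← hR, h2, ENNReal.mul_top] at h1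
    · exact h1 rfl
    · simpa using hD (Sum.inl i)
  have htail : Integrable fun y => (tailIntegral f (R y)).toReal :=
    integrable_toReal_of_lintegral_ne_top
      ((measurable_tailIntegral hf).comp hRm).aemeasurable htop
  have hZ2 (k : β) : Integrable fun y => (y (Sum.inr k) - m (Sum.inr k)) ^ 2 * f (R y) := by
    rw [← lintegral_ofReal_ne_top_iff_integrable (by fun_prop)
      (ae_of_all _ fun y => mul_nonneg (sq_nonneg _) (hf0 _)), hR,
      lintegral_sub_sq_mul_comp_diagForm hf m hD, ← hR]
    exact ENNReal.mul_ne_top (by simp) htop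
  -- the vector field and the bounds for its partial derivatives
  set GX : α → (α ⊕ β → ℝ) → ℝ := fun i y => -2 * g y * y (Sum.inl i) / c i with hGX
  set GZ : β → (α ⊕ β → ℝ) → ℝ := fun k y => y (Sum.inr k) * P y with hGZ
  set UX : α → (α ⊕ β → ℝ) → ℝ := fun i y => -2 * (g y / c i -
    2 * g y * (y (Sum.inl i) ^ 2 / (c i ^ 2 * d i * A y))) with hUX
  set UZ : β → (α ⊕ β → ℝ) → ℝ := fun k y =>
    P y + 2 * (y (Sum.inr k) ^ 2 / S y) * P y with hUZ
  have hUXm (i) : Measurable (UX i) := by fun_prop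
  have hUZm (k) : Measurable (UZ k) := by fun_prop
  have hUXC (i) (y) : |UX i y| ≤ 6 * v / c i := by
    have hci := hc i
    have hdi := hd i
    have h1 : 0 ≤ y (Sum.inl i) ^ 2 / (c i ^ 2 * d i * A y) := by
      have := hA0 y
      positivity
    have h2 : y (Sum.inl i) ^ 2 / (c i ^ 2 * d i * A y) ≤ 1 / c i := by
      calc y (Sum.inl i) ^ 2 / (c i ^ 2 * d i * A y)
          = y (Sum.inl i) ^ 2 / (c i * d i) / A y / c i := by field_simp
        _ ≤ 1 / c i := by
          gcongr
          exact div_le_one_of_le₀ (hxA i y) (hA0 y)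
    have h3 : 0 ≤ g y := hψ0 _
    have h4 : g y ≤ v := hψv _
    have h5 : UX i y = 2 * g y * (2 * (y (Sum.inl i) ^ 2 / (c i ^ 2 * d i * A y)) - 1 / c i) := by
      simp only [hUX]
      ring
    have h6 : 0 < 1 / c i := by positivity
    rw [h5, abs_mul, abs_of_nonneg (by positivity : 0 ≤ 2 * g y),
      show 6 * v / c i = 2 * v * (3 * (1 / c i)) by ring]
    have h7 : |2 * (y (Sum.inl i) ^ 2 / (c i ^ 2 * d i * A y)) - 1 / c i| ≤ 3 * (1 / c i) := by
      rw [abs_le]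
      constructor <;> linarith
    gcongr
  have hUZC (k) (y) : |UZ k y| ≤ 3 * (v * (M * L)) := by
    have h1 : 0 ≤ y (Sum.inr k) ^ 2 / S y := div_nonneg (sq_nonneg _) (hS0 y)
    have h2 : y (Sum.inr k) ^ 2 / S y ≤ 1 := div_le_one_of_le₀ (hzS k y) (hS0 y)
    have h3 := hP0 y
    have h4 := hPK y
    rw [abs_of_nonneg (by positivity)]
    simp only [hUZ]
    nlinarith
  have hGXint (i : α) :
      Integrable fun y => (y (Sum.inl i) - m (Sum.inl i)) * GX i y * f (R y) := by
    have hci := hc i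
    refine (((hX2 i).const_mul (4 * v / c i)).add (hf1.const_mul (2 * v / c i * θ i ^ 2))).mono'
      (by fun_prop) (ae_of_all _ fun y => ?_)
    have h3 : 0 ≤ g y := hψ0 _
    have h4 : g y ≤ v := hψv _
    have h5 := hf0 (R y)
    simp only [hGX, hm, Sum.elim_inl, Pi.add_apply]
    set x := y (Sum.inl i)
    have h6 : |(x - θ i) * x| ≤ 2 * (x - θ i) ^ 2 + θ i ^ 2 := by
      rw [abs_le]
      constructor <;> nlinarith [sq_nonneg (x - θ i + θ i), sq_nonneg (x - θ i - θ i),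
        sq_nonneg (x - θ i), sq_nonneg (θ i)]
    calc ‖(x - θ i) * (-2 * g y * x / c i) * f (R y)‖
        = 2 * g y / c i * |(x - θ i) * x| * f (R y) := by
          rw [show (x - θ i) * (-2 * g y * x / c i) * f (R y) =
            -(2 * g y / c i * ((x - θ i) * x) * f (R y)) by ring, norm_neg, norm_mul, norm_mul,
            Real.norm_of_nonneg h5, Real.norm_of_nonneg (by positivity : 0 ≤ 2 * g y / c i),
            Real.norm_eq_abs]
      _ ≤ 2 * v / c i * (2 * (x - θ i) ^ 2 + θ i ^ 2) * f (R y) := by gcongr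
      _ = _ := by ring
  have hQint : Integrable fun y => Q y * f (R y) := by
    have h (i : α) : Integrable fun y => y (Sum.inl i) ^ 2 / c i ^ 2 * f (R y) := by
      refine (((hX2 i).const_mul (2 / c i ^ 2)).add
        (hf1.const_mul (2 * θ i ^ 2 / c i ^ 2))).mono' (by fun_prop) (ae_of_all _ fun y => ?_)
      have h5 := hf0 (R y)
      rw [Real.norm_of_nonneg (by positivity)]
      simp only [hm, Sum.elim_inl, Pi.add_apply]
      set x := y (Sum.inl i)
      have h6 : x ^ 2 ≤ 2 * (x - θ i) ^ 2 + 2 * θ i ^ 2 := by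
        nlinarith [sq_nonneg (x - θ i - θ i)]
      calc x ^ 2 / c i ^ 2 * f (R y)
          ≤ (2 * (x - θ i) ^ 2 + 2 * θ i ^ 2) / c i ^ 2 * f (R y) := by gcongr
        _ = _ := by ring
    have := integrable_finsetSum univ fun i _ => h i
    simpa only [Q, directionSq, sum_mul] using this
  have hGZint (k : β) :
      Integrable fun y => (y (Sum.inr k) - m (Sum.inr k)) * GZ k y * f (R y) := by
    refine (hQint.const_mul (v ^ 2)).mono' (by fun_prop) (ae_of_all _ fun y => ?_)
    have h1 : 0 ≤ y (Sum.inr k) ^ 2 / S y := div_nonneg (sq_nonneg _) (hS0 y)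
    have h2 : y (Sum.inr k) ^ 2 / S y ≤ 1 := div_le_one_of_le₀ (hzS k y) (hS0 y)
    have h3 : 0 ≤ g y := hψ0 _
    have h4 : g y ≤ v := hψv _
    have h5 := hf0 (R y)
    have h6 := hQ0 y
    have h7 : (y (Sum.inr k) - m (Sum.inr k)) * GZ k y * f (R y) =
        y (Sum.inr k) ^ 2 / S y * (g y ^ 2 * (Q y * f (R y))) := by
      simp only [hGZ, hP, hm, Sum.elim_inr, Pi.zero_apply]
      ring
    rw [h7, Real.norm_of_nonneg (by positivity)]
    calc y (Sum.inr k) ^ 2 / S y * (g y ^ 2 * (Q y * f (R y)))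
        ≤ 1 * (v ^ 2 * (Q y * f (R y))) := by gcongr
      _ = _ := one_mul _
  have hUXt (i : α) : Integrable fun y => UX i y * (tailIntegral f (R y)).toReal :=
    htail.bdd_mul (hUXm i).aestronglyMeasurable (ae_of_all _ (hUXC i))
  have hUZt (k : β) : Integrable fun y => UZ k y * (tailIntegral f (R y)).toReal :=
    htail.bdd_mul (hUZm k).aestronglyMeasurable (ae_of_all _ (hUZC k))
  -- integration by parts
  have hXle (i : α) : ∫ y, (y (Sum.inl i) - m (Sum.inl i)) * GX i y * f (R y) ≤
      D (Sum.inl i) / 2 * ∫ y, UX i y * (tailIntegral f (R y)).toReal := by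
    have h := hX2 i
    have h' := hGXint i
    simp only [hR] at h h' htail ⊢
    refine integral_sub_mul_comp_diagForm_le hf hf0 m hD (Sum.inl i) (hUXm i) (hUXC i) h htail h' ?_
    filter_upwards [hne] with y hy s hs
    obtain ⟨k, hk⟩ := exists_ne i
    have hB : 0 < ∑ k ∈ univ.erase i, y (Sum.inl k) ^ 2 / (c k * d k) := by
      refine sum_pos (fun k _ => ?_) ⟨k, by simp [hk]⟩
      have := hc k
      have := hd k
      have := hy (Sum.inl k)
      positivity
    have hS : 0 < S y := by
      obtain ⟨k⟩ := (inferInstance : Nonempty β)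
      have := hy (Sum.inr k)
      exact lt_of_lt_of_le (by positivity) (hzS k y)
    have := shrinkage_increment_le hψ hψ' (hc i) (hd i) hB hS
      (show m (Sum.inl i) - s ≤ m (Sum.inl i) + s by linarith)
    simpa only [hGX, hUX, hg, A, S, weightedSq_update_inl, residualSq_update_inl,
      Function.update_self] using this
  have hZle (k : β) : ∫ y, (y (Sum.inr k) - m (Sum.inr k)) * GZ k y * f (R y) ≤
      D (Sum.inr k) / 2 * ∫ y, UZ k y * (tailIntegral f (R y)).toReal := by
    have h := hZ2 k
    have h' := hGZint k
    simp only [hR] at h h' htail ⊢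
    refine integral_sub_mul_comp_diagForm_le hf hf0 m hD (Sum.inr k) (hUZm k) (hUZC k) h htail h' ?_
    filter_upwards [hne] with y hy s hs
    have hA : 0 < A y := by
      obtain ⟨i⟩ := (inferInstance : Nonempty α)
      have := hy (Sum.inl i)
      have := hc i
      have := hd i
      exact lt_of_lt_of_le (by positivity) (hxA i y)
    have hB : 0 ≤ ∑ l ∈ univ.erase k, y (Sum.inr l) ^ 2 := sum_nonneg fun _ _ => sq_nonneg _
    have hK (z : ℝ) : |ψ (A y / (z ^ 2 + ∑ l ∈ univ.erase k, y (Sum.inr l) ^ 2)) ^ 2 * Q y /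
        (z ^ 2 + ∑ l ∈ univ.erase k, y (Sum.inr l) ^ 2)| ≤ v * (M * L) := by
      have h1 := hP0 (Function.update y (Sum.inr k) z)
      have h2 := hPK (Function.update y (Sum.inr k) z)
      rw [← abs_of_nonneg h1] at h2
      simpa only [hP, hg, A, S, Q, weightedSq_update_inr, residualSq_update_inr,
        directionSq_update_inr] using h2
    have := residual_increment_le hψ hψ' hψ0 hA hB (hQ0 y) hψm hK hs
    simpa only [hGZ, hUZ, hP, hg, hm, A, S, Q, weightedSq_update_inr, residualSq_update_inr,
      directionSq_update_inr, Function.update_self, Sum.elim_inr, Pi.zero_apply, zero_add,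
      zero_sub] using this
  -- assembling
  have hdiv : ∀ᵐ y : α ⊕ β → ℝ, ∑ i, d i * UX i y + ∑ k, UZ k y ≤ 0 := by
    filter_upwards [hne] with y hy
    have hA : 0 < A y := by
      obtain ⟨i⟩ := (inferInstance : Nonempty α)
      have := hy (Sum.inl i)
      have := hc i
      have := hd i
      exact lt_of_lt_of_le (by positivity) (hxA i y)
    have hS : 0 < S y := by
      obtain ⟨k⟩ := (inferInstance : Nonempty β)
      have := hy (Sum.inr k)
      exact lt_of_lt_of_le (by positivity) (hzS k y)
    have h1 : ∑ i, d i * UX i y = -2 * g y * ∑ i, d i / c i + 4 * g y * (Q y / A y) := by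
      simp only [Q, directionSq, sum_div, mul_sum, ← sum_add_distrib]
      refine sum_congr rfl fun i _ => ?_
      have := hc i
      have := hd i
      simp only [hUX]
      field_simp
      ring
    have h2 : ∑ k, UZ k y = (Fintype.card β + 2) * P y := by
      simp only [hUZ, sum_add_distrib, sum_const, card_univ, nsmul_eq_mul, ← sum_mul, ← mul_sum,
        ← sum_div]
      change _ + 2 * (S y / S y) * P y = _
      rw [div_self hS.ne']
      ring
    have h3 : P y = g y * (Q y / A y) * (A y / S y * g y) := by
      simp only [hP]
      field_simp
    have h4 : Q y / A y ≤ M := by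
      rw [div_le_iff₀ hA]
      exact hQA y
    have h5 : 0 ≤ Q y / A y := div_nonneg (hQ0 y) hA.le
    have h6 : A y / S y * g y ≤ L := hψL _
    have h7 : 0 ≤ g y := hψ0 _
    rw [h1, h2, h3]
    have h8 : Q y / A y * (4 + (Fintype.card β + 2) * (A y / S y * g y)) ≤
        M * (4 + (Fintype.card β + 2) * L) := by
      gcongr
    have h9 := mul_le_mul_of_nonneg_left (h8.trans hL) h7
    linarith
  have hloss : ∀ᵐ y : α ⊕ β → ℝ,
      (∑ i, ((1 - g y / c i) * y (Sum.inl i) - θ i) ^ 2) * f (R y) =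
      (∑ i, (y (Sum.inl i) - θ i) ^ 2) * f (R y) +
        (∑ i, (y (Sum.inl i) - m (Sum.inl i)) * GX i y * f (R y) +
          ∑ k, (y (Sum.inr k) - m (Sum.inr k)) * GZ k y * f (R y)) := by
    filter_upwards [hne] with y hy
    have hS : 0 < S y := by
      obtain ⟨k⟩ := (inferInstance : Nonempty β)
      have := hy (Sum.inr k)
      exact lt_of_lt_of_le (by positivity) (hzS k y)
    have h1 : ∑ k, (y (Sum.inr k) - m (Sum.inr k)) * GZ k y = g y ^ 2 * Q y := by
      have : ∑ k, (y (Sum.inr k) - m (Sum.inr k)) * GZ k y = S y * P y := by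
        simp only [S, residualSq, sum_mul, hGZ, hm, Sum.elim_inr, Pi.zero_apply]
        exact sum_congr rfl fun k _ => by ring
      rw [this]
      simp only [hP]
      field_simp
    rw [← sum_mul, ← sum_mul, h1, ← add_mul, ← add_mul]
    congr 1
    simp only [Q, directionSq, mul_sum, ← sum_add_distrib]
    refine sum_congr rfl fun i _ => ?_
    have := hc i
    simp only [hGX, hm, Sum.elim_inl]
    field_simp
    ring
  have hGXsum := integrable_finsetSum univ fun i _ => hGXint i
  have hGZsum := integrable_finsetSum univ fun k _ => hGZint k
  rw [integral_congr_ae hloss, integral_add hf2 (hGXsum.add hGZsum :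
      Integrable fun y => ∑ i, (y (Sum.inl i) - m (Sum.inl i)) * GX i y * f (R y) +
        ∑ k, (y (Sum.inr k) - m (Sum.inr k)) * GZ k y * f (R y)),
    integral_add hGXsum hGZsum,
    integral_finsetSum _ fun i _ => hGXint i, integral_finsetSum _ fun k _ => hGZint k]
  have hfin : (∑ i, D (Sum.inl i) / 2 * ∫ y, UX i y * (tailIntegral f (R y)).toReal) +
      ∑ k, D (Sum.inr k) / 2 * ∫ y, UZ k y * (tailIntegral f (R y)).toReal =
      σ ^ 2 / 2 * ∫ y, (∑ i, d i * UX i y + ∑ k, UZ k y) * (tailIntegral f (R y)).toReal := by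
    have h1 (y) : (∑ i, d i * UX i y + ∑ k, UZ k y) * (tailIntegral f (R y)).toReal =
        ∑ i, d i * (UX i y * (tailIntegral f (R y)).toReal) +
          ∑ k, UZ k y * (tailIntegral f (R y)).toReal := by
      simp only [add_mul, sum_mul, mul_assoc]
    simp only [h1]
    rw [integral_add (integrable_finsetSum _ fun i _ => (hUXt i).const_mul (d i))
      (integrable_finsetSum _ fun k _ => hUZt k),
      integral_finsetSum _ fun i _ => (hUXt i).const_mul (d i),
      integral_finsetSum _ fun k _ => hUZt k, mul_add, mul_sum, mul_sum]
    simp only [integral_const_mul, hDdef, Sum.elim_inl, Sum.elim_inr]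
    congr 1
    exact sum_congr rfl fun i _ => by ring
  have hneg : ∫ y, (∑ i, d i * UX i y + ∑ k, UZ k y) * (tailIntegral f (R y)).toReal ≤ 0 := by
    refine integral_nonpos_of_ae ?_
    filter_upwards [hdiv] with y hy
    exact mul_nonpos_of_nonpos_of_nonneg hy ENNReal.toReal_nonneg
  have hsum := add_le_add (sum_le_sum fun i (_ : i ∈ univ) => hXle i)
    (sum_le_sum fun k (_ : k ∈ univ) => hZle k)
  rw [hfin] at hsum
  have hσ2 : 0 ≤ σ ^ 2 / 2 := by positivity
  linarith [mul_nonpos_of_nonneg_of_nonpos hσ2 hneg]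

end Risk

/-- Shrinking the eigenvalues `d i` by the factors `1 - t / c i` does not increase the condition
number, for `t` below the stated threshold. -/
lemma sup_div_inf_shrinkage_le {ι : Type*} [Fintype ι] (hne : (univ : Finset ι).Nonempty)
    {d c : ι → ℝ} {first mid last : ι} {t : ℝ} (hd : ∀ i, 0 < d i) (hfirst : ∀ i, d i ≤ d first)
    (hmid : ∀ i, i ≠ last → d mid ≤ d i) (hlast : ∀ i, d last ≤ d i)
    (hc_mid : c mid = 1) (hc_one : ∀ i, i ≠ last → 1 ≤ c i)
    (hc_first : ∀ i, i ≠ last → c i ≤ c first) (hc_last : c first < c last)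
    (hfl : first ≠ last) (ht0 : 0 ≤ t)
    (ht : t ≤ min (c first * c mid * (d mid - d last) / (c first * d mid - c mid * d last))
      (c mid * c last * (d first * d mid - d last ^ 2) /
        (c last * d first * d mid - c mid * d last ^ 2))) :
    univ.sup' hne (fun i => d i * (1 - t / c i)) / univ.inf' hne (fun i => d i * (1 - t / c i)) ≤
      d first / d last := by
  rw [hc_mid] at ht
  simp only [mul_one, one_mul] at ht
  obtain ⟨ht1, ht2⟩ := le_min_iff.1 ht
  have hf1 := hc_one first hfl
  have hl1 : 1 ≤ c last := hf1.trans hc_last.le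
  have hone (i : ι) : 1 ≤ c i := by
    by_cases h : i = last
    · exact h ▸ hl1
    · exact hc_one i h
  have ha := hd mid
  have hb := hd last
  have hda := hfirst mid
  have hab := hlast mid
  have hD : 0 < d first := hd first
  have hsq : d last ^ 2 ≤ d first * d mid := by
    rw [sq]
    exact mul_le_mul (hlast first) hab hb.le hD.le
  have hden1 : c first * (d mid - d last) ≤ c first * d mid - d last := by nlinarith
  have hden2 : c last * (d first * d mid - d last ^ 2) ≤
      c last * d first * d mid - d last ^ 2 := by nlinarith [sq_nonneg (d last)]
  have hnum1 : 0 ≤ c first * (d mid - d last) := mul_nonneg (by linarith) (by linarith)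
  have hnum2 : 0 ≤ c last * (d first * d mid - d last ^ 2) :=
    mul_nonneg (by linarith) (by linarith)
  have ht_one : t ≤ 1 :=
    ht1.trans (div_le_one_of_le₀ hden1 (hnum1.trans hden1))
  have hI1 := mul_le_of_le_div₀ hnum1 (hnum1.trans hden1) ht1
  have hI2 := mul_le_of_le_div₀ hnum2 (hnum2.trans hden2) ht2
  have hfactor (i : ι) : 0 ≤ 1 - t / c i :=
    sub_nonneg.2 (div_le_one_of_le₀ (ht_one.trans (hone i)) (by linarith [hone i]))
  have hcf : 0 < c first := by linarith
  have hcl : 0 < c last := by linarith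
  have hJ1 : (1 - t / c first) * d last ≤ d mid * (1 - t) := by
    have h : c first * ((1 - t / c first) * d last) ≤ c first * (d mid * (1 - t)) := by
      have h' : c first * ((1 - t / c first) * d last) = (c first - t) * d last := by field_simp
      rw [h']
      linarith
    exact le_of_mul_le_mul_left h hcf
  have hJ2 : d last * (1 - t / c last) * d last ≤ d first * (d mid * (1 - t)) := by
    have h : c last * (d last * (1 - t / c last) * d last) ≤
        c last * (d first * (d mid * (1 - t))) := by
      have h' : c last * (d last * (1 - t / c last) * d last) = (c last - t) * d last ^ 2 := by
        field_simp
      rw [h']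
      linarith
    exact le_of_mul_le_mul_left h hcl
  have hlow (k : ι) (hk : k ≠ last) : d mid * (1 - t) ≤ d k * (1 - t / c k) := by
    refine mul_le_mul (hmid k hk) ?_ (by linarith) (hd k).le
    linarith [div_le_self ht0 (hone k)]
  have hup (i : ι) (hi : i ≠ last) : d i * (1 - t / c i) ≤ d first * (1 - t / c first) := by
    refine mul_le_mul (hfirst i) ?_ (hfactor i) hD.le
    have : 0 < c i := by linarith [hone i]
    have := div_le_div_of_nonneg_left ht0 this (hc_first i hi)
    linarith
  have hkey (i k : ι) : d i * (1 - t / c i) * d last ≤ d first * (d k * (1 - t / c k)) := by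
    by_cases hi : i = last
    · by_cases hk : k = last
      · rw [hi, hk, mul_comm]
        exact mul_le_mul_of_nonneg_right (hlast first) (mul_nonneg hb.le (hfactor last))
      · rw [hi]
        exact hJ2.trans (mul_le_mul_of_nonneg_left (hlow k hk) hD.le)
    · refine (mul_le_mul_of_nonneg_right (hup i hi) hb.le).trans ?_
      rw [mul_assoc]
      refine mul_le_mul_of_nonneg_left ?_ hD.le
      by_cases hk : k = last
      · rw [hk, mul_comm]
        refine mul_le_mul_of_nonneg_left ?_ hb.le
        linarith [div_le_div_of_nonneg_left ht0 hcf hc_last.le]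
      · exact hJ1.trans (hlow k hk)
  obtain ⟨i, -, hi⟩ := exists_mem_eq_sup' hne (fun i => d i * (1 - t / c i))
  obtain ⟨k, -, hk⟩ := exists_mem_eq_inf' hne (fun i => d i * (1 - t / c i))
  rw [hi, hk]
  rcases (mul_nonneg (hd k).le (hfactor k)).eq_or_lt with h | h
  · rw [← h, div_zero]
    positivity
  · rw [div_le_div_iff₀ h hb]
    exact hkey i k

/-- A function with nonnegative derivative on `(0, ∞)` is bounded there by its limit. -/
lemma le_of_deriv_nonneg_of_tendsto {φ : ℝ → ℝ} {L : ℝ}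
    (hdiff : ∀ w > (0 : ℝ), DifferentiableAt ℝ φ w) (hderiv : ∀ w > (0 : ℝ), 0 ≤ deriv φ w)
    (hlim : Tendsto φ atTop (nhds L)) {w : ℝ} (hw : 0 < w) : φ w ≤ L := by
  have hmono : MonotoneOn φ (Set.Ioi 0) := by
    refine monotoneOn_of_deriv_nonneg (convex_Ioi 0)
      (fun x hx => (hdiff x hx).continuousAt.continuousWithinAt) ?_ ?_
    · rw [interior_Ioi]
      exact fun x hx => (hdiff x hx).differentiableWithinAt
    · rw [interior_Ioi]
      exact fun x hx => hderiv x hx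
  refine ge_of_tendsto hlim ?_
  filter_upwards [eventually_ge_atTop w] with x hx
  exact hmono hw (hw.trans_le hx) hx

/-- Theorem 4.3: suppose `p ≥ 3` and `∑ (d_i/d₁)^{1−j} ≤ 2`. With `ν_**` chosen in
`[0, ν_*)` when `p ≥ 4` (where `ν_* ∈ (0,1−j)` is the root of
`∑_{i=1}^{p−1} (d_i/d₁)^ν = 2`) and `ν_** = 0` when `p = 3`, set
`c_i = (d_i/d_{p−1})^{1−j−ν_**}` for `i < p` and choose any `c_p > c₁`.  With
`u₋ = (2/(n+2))(∑_{i=1}^{p−1} (d_i/d₁)^{ν_**} − 2 + (c₁/c_p)(d_p/d₁)^{1−j})` and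
`v₋` the stated minimum, any `θ̂_φ` with `φ` differentiable nondecreasing,
`0 ≤ φ(w)/w ≤ v₋` and `lim_{w→∞} φ(w) ≤ u₋` is minimax under `L_j` and does not
increase the condition number. -/
theorem stmt_15
    (p n : ℕ) (hp : 3 ≤ p) (hn : 0 < n) (j : ℕ)
    (d c : Fin p → ℝ)
    (hd_pos : ∀ i, 0 < d i)
    (hd_mono : ∀ i k : Fin p, i ≤ k → d k ≤ d i)
    (hsum : ∑ i, (d i / d ⟨0, by omega⟩) ^ ((1 : ℝ) - j) ≤ 2)
    (ν : ℝ)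
    (hν : (4 ≤ p ∧ ∃ νs : ℝ, 0 < νs ∧ νs < (1 : ℝ) - j ∧
        (∑ i ∈ univ.filter (fun i : Fin p => (i : ℕ) + 1 < p),
          (d i / d ⟨0, by omega⟩) ^ νs) = 2 ∧ 0 ≤ ν ∧ ν < νs) ∨
      (p = 3 ∧ ν = 0))
    (hc : ∀ i : Fin p, (i : ℕ) + 1 < p →
      c i = (d i / d ⟨p - 2, by omega⟩) ^ ((1 : ℝ) - j - ν))
    (hcp : c ⟨0, by omega⟩ < c ⟨p - 1, by omega⟩)
    (f : ℝ → ℝ) (hf_nonneg : ∀ t, 0 ≤ f t) (hf_meas : Measurable f)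
    (φ : ℝ → ℝ)
    (hφ_diff : ∀ w > (0:ℝ), DifferentiableAt ℝ φ w)
    (hφ_incr : ∀ w > (0:ℝ), 0 ≤ deriv φ w)
    -- `0 ≤ φ(w)/w ≤ v₋` for all `w > 0`
    (hφ_ratio_nonneg : ∀ w > (0:ℝ), 0 ≤ φ w / w)
    (hφ_ratio_le : ∀ w > (0:ℝ), φ w / w ≤ min
      (c ⟨0, by omega⟩ * c ⟨p - 2, by omega⟩ *
          (d ⟨p - 2, by omega⟩ - d ⟨p - 1, by omega⟩) /
        (c ⟨0, by omega⟩ * d ⟨p - 2, by omega⟩ -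
          c ⟨p - 2, by omega⟩ * d ⟨p - 1, by omega⟩))
      (c ⟨p - 2, by omega⟩ * c ⟨p - 1, by omega⟩ *
          (d ⟨0, by omega⟩ * d ⟨p - 2, by omega⟩ - d ⟨p - 1, by omega⟩ ^ 2) /
        (c ⟨p - 1, by omega⟩ * d ⟨0, by omega⟩ * d ⟨p - 2, by omega⟩ -
          c ⟨p - 2, by omega⟩ * d ⟨p - 1, by omega⟩ ^ 2)))
    -- `lim_{w→∞} φ(w) ≤ u₋`
    (L : ℝ) (hφ_lim : Tendsto φ atTop (nhds L))
    (hL : L ≤ 2 / ((n : ℝ) + 2) *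
      ((∑ i ∈ univ.filter (fun i : Fin p => (i : ℕ) + 1 < p),
          (d i / d ⟨0, by omega⟩) ^ ν) - 2 +
        (c ⟨0, by omega⟩ / c ⟨p - 1, by omega⟩) *
          (d ⟨p - 1, by omega⟩ / d ⟨0, by omega⟩) ^ ((1 : ℝ) - j)))
    (θ : Fin p → ℝ) (σ : ℝ) (hσ : 0 < σ)
    (dens : ((Fin p → ℝ) × (Fin n → ℝ)) → ℝ)
    (hdens : dens = fun q => (∏ i, (d i) ^ (-(1:ℝ)/2)) * σ ^ (-(p : ℝ) - n) *
      f (((∑ i, (q.1 i - θ i) ^ 2 / d i) + ∑ k, (q.2 k) ^ 2) / σ ^ 2))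
    (hnorm : ∫ q, dens q = 1)
    (est : ((Fin p → ℝ) × (Fin n → ℝ)) → Fin p → ℝ)
    (hest : est = fun q i =>
      (1 - φ ((∑ i', (q.1 i') ^ 2 / (c i' * d i')) / (∑ k, (q.2 k) ^ 2)) /
          ((∑ i', (q.1 i') ^ 2 / (c i' * d i')) / (∑ k, (q.2 k) ^ 2)) / c i) * q.1 i)
    (h_int_est : Integrable (fun q => (∑ i, (est q i - θ i) ^ 2 / d i ^ j) / σ ^ 2 * dens q))
    (h_int_ls : Integrable (fun q => (∑ i, (q.1 i - θ i) ^ 2 / d i ^ j) / σ ^ 2 * dens q)) :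
    -- (a) minimaxity: the risk of `θ̂_φ` is no larger than that of `X`
    (∫ q, (∑ i, (est q i - θ i) ^ 2 / d i ^ j) / σ ^ 2 * dens q ≤
      ∫ q, (∑ i, (q.1 i - θ i) ^ 2 / d i ^ j) / σ ^ 2 * dens q) ∧
    -- (b) the condition number is not increased, for every shrinkage factor `t = φ(w)/w`
    (∀ w > (0:ℝ),
      (univ.sup' (univ_nonempty_iff.mpr ⟨⟨0, by omega⟩⟩)
          (fun i => d i * (1 - φ w / w / c i))) /
        (univ.inf' (univ_nonempty_iff.mpr ⟨⟨0, by omega⟩⟩)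
          (fun i => d i * (1 - φ w / w / c i)))
        ≤ d ⟨0, by omega⟩ / d ⟨p - 1, by omega⟩) := by
  have hd0 := hd_pos ⟨0, by omega⟩
  have hratio_pos (i : Fin p) : 0 < d i / d ⟨0, by omega⟩ := div_pos (hd_pos i) hd0
  have hfirst (i : Fin p) : d i ≤ d ⟨0, by omega⟩ := hd_mono _ _ (Nat.zero_le _)
  have hratio_le (i : Fin p) : d i / d ⟨0, by omega⟩ ≤ 1 := div_le_one_of_le₀ (hfirst i) hd0.le
  -- the condition on the sum forces `j = 0`
  obtain rfl : j = 0 := by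
    by_contra hj
    have hj1 : (1 : ℝ) ≤ j := by exact_mod_cast Nat.one_le_iff_ne_zero.2 hj
    have h1 : ∑ _i : Fin p, (1 : ℝ) ≤ ∑ i, (d i / d ⟨0, by omega⟩) ^ ((1 : ℝ) - j) :=
      sum_le_sum fun i _ => Real.one_le_rpow_of_pos_of_le_one_of_nonpos (hratio_pos i)
        (hratio_le i) (by linarith)
    have h2 : (3 : ℝ) ≤ p := by exact_mod_cast hp
    simp only [sum_const, card_univ, Fintype.card_fin, nsmul_eq_mul, mul_one] at h1
    linarith
  simp only [Nat.cast_zero, sub_zero, Real.rpow_one, pow_zero, div_one] at *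
  have hν0 : 0 ≤ ν := by
    rcases hν with ⟨-, νs, -, -, -, h, -⟩ | ⟨-, h⟩
    · exact h
    · exact h.ge
  have hν1 : 0 ≤ 1 - ν := by
    rcases hν with ⟨-, νs, -, h1, -, -, h2⟩ | ⟨-, h⟩ <;> linarith
  have hlt {i : Fin p} (hi : i ≠ ⟨p - 1, by omega⟩) : (i : ℕ) + 1 < p := by
    have := i.2
    have : (i : ℕ) ≠ p - 1 := fun h => hi (Fin.ext h)
    omega
  have ha := hd_pos ⟨p - 2, by omega⟩
  have hmid (i : Fin p) (hi : i ≠ ⟨p - 1, by omega⟩) : d ⟨p - 2, by omega⟩ ≤ d i := by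
    refine hd_mono _ _ ?_
    have := hlt hi
    rw [Fin.le_def]
    simp only
    omega
  have hlast (i : Fin p) : d ⟨p - 1, by omega⟩ ≤ d i := by
    refine hd_mono _ _ ?_
    have := i.2
    rw [Fin.le_def]
    simp only
    omega
  have hfl : (⟨0, by omega⟩ : Fin p) ≠ ⟨p - 1, by omega⟩ := by
    rw [Ne, Fin.mk.injEq]
    omega
  have hc_mid : c ⟨p - 2, by omega⟩ = 1 := by
    rw [hc _ (by simp only; omega), div_self ha.ne', Real.one_rpow]
  have hc_one (i : Fin p) (hi : i ≠ ⟨p - 1, by omega⟩) : 1 ≤ c i := by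
    rw [hc i (hlt hi)]
    exact Real.one_le_rpow ((one_le_div ha).2 (hmid i hi)) hν1
  have hc_first (i : Fin p) (hi : i ≠ ⟨p - 1, by omega⟩) : c i ≤ c ⟨0, by omega⟩ := by
    rw [hc i (hlt hi), hc _ (hlt hfl)]
    have := hd_pos i
    exact Real.rpow_le_rpow (by positivity) (by gcongr; exact hfirst i) hν1
  have hc0 : 0 < c ⟨0, by omega⟩ := by linarith [hc_one _ hfl]
  have hcl : 0 < c ⟨p - 1, by omega⟩ := hc0.trans hcp
  have hc_pos (i : Fin p) : 0 < c i := by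
    by_cases hi : i = ⟨p - 1, by omega⟩
    · exact hi ▸ hcl
    · linarith [hc_one i hi]
  refine ⟨?_, fun w hw => sup_div_inf_shrinkage_le _ hd_pos hfirst hmid hlast hc_mid hc_one
    hc_first hcp hfl (hφ_ratio_nonneg w hw) (hφ_ratio_le w hw)⟩
  -- the ratios `d i / c i`
  set M := d ⟨0, by omega⟩ / c ⟨0, by omega⟩ with hMdef
  have hM0 : 0 < M := div_pos hd0 hc0
  have hdc (i : Fin p) (hi : i ≠ ⟨p - 1, by omega⟩) :
      d i / c i = M * (d i / d ⟨0, by omega⟩) ^ ν := by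
    have h1 : c i = c ⟨0, by omega⟩ * (d i / d ⟨0, by omega⟩) ^ (1 - ν) := by
      rw [hc i (hlt hi), hc _ (hlt hfl), ← Real.mul_rpow (by positivity) (hratio_pos i).le]
      congr 1
      field_simp
    have h2 : (d i / d ⟨0, by omega⟩) ^ ν * (d i / d ⟨0, by omega⟩) ^ (1 - ν) =
        d i / d ⟨0, by omega⟩ := by
      rw [← Real.rpow_add (hratio_pos i), add_sub_cancel, Real.rpow_one]
    rw [div_eq_iff (hc_pos i).ne', h1, hMdef]
    calc d i = d ⟨0, by omega⟩ * (d i / d ⟨0, by omega⟩) := by field_simp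
      _ = d ⟨0, by omega⟩ * ((d i / d ⟨0, by omega⟩) ^ ν *
          (d i / d ⟨0, by omega⟩) ^ (1 - ν)) := by rw [h2]
      _ = _ := by
        field_simp
  have hdcl : d ⟨p - 1, by omega⟩ / c ⟨p - 1, by omega⟩ = M * (c ⟨0, by omega⟩ /
      c ⟨p - 1, by omega⟩ * (d ⟨p - 1, by omega⟩ / d ⟨0, by omega⟩)) := by
    rw [hMdef]
    field_simp
  have hM (i : Fin p) : d i / c i ≤ M := by
    by_cases hi : i = ⟨p - 1, by omega⟩
    · rw [hi]
      exact div_le_div₀ hd0.le (hfirst _) hc0 hcp.le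
    · rw [hdc i hi]
      exact mul_le_of_le_one_right hM0.le
        (Real.rpow_le_one (hratio_pos i).le (hratio_le i) hν0)
  have hsum_dc : ∑ i, d i / c i = M * ((∑ i ∈ univ.filter (fun i : Fin p => (i : ℕ) + 1 < p),
      (d i / d ⟨0, by omega⟩) ^ ν) + c ⟨0, by omega⟩ / c ⟨p - 1, by omega⟩ *
        (d ⟨p - 1, by omega⟩ / d ⟨0, by omega⟩)) := by
    have hfilter : univ.filter (fun i : Fin p => (i : ℕ) + 1 < p) =
        univ.erase ⟨p - 1, by omega⟩ := by
      ext i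
      simp only [mem_filter, mem_univ, true_and, mem_erase, and_true]
      refine ⟨fun h h' => ?_, hlt⟩
      rw [h'] at h
      simp only at h
      omega
    rw [← sum_erase_add _ _ (mem_univ (⟨p - 1, by omega⟩ : Fin p)), hdcl, mul_add, mul_sum,
      hfilter]
    congr 1
    exact sum_congr rfl fun i hi => hdc i (ne_of_mem_erase hi)
  have hbound : M * (4 + (Fintype.card (Fin n) + 2) * L) ≤ 2 * ∑ i, d i / c i := by
    have hn2 : (0 : ℝ) < n + 2 := by positivity
    rw [hsum_dc, Fintype.card_fin, mul_left_comm]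
    refine mul_le_mul_of_nonneg_left ?_ hM0.le
    have h := mul_le_mul_of_nonneg_left hL hn2.le
    rw [← mul_assoc, mul_div_cancel₀ _ hn2.ne'] at h
    linarith
  -- the shrinkage factor
  obtain ⟨v, hφ_ratio_le⟩ : ∃ v, ∀ w > (0 : ℝ), φ w / w ≤ v := ⟨_, hφ_ratio_le⟩
  have hv0 : 0 ≤ v := (hφ_ratio_nonneg 1 one_pos).trans (hφ_ratio_le 1 one_pos)
  set ψ : ℝ → ℝ := (Set.Ioi (0 : ℝ)).piecewise (fun w => φ w / w) fun _ => 0 with hψdef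
  have hψpos {w : ℝ} (hw : 0 < w) : ψ w = φ w / w := Set.piecewise_eq_of_mem _ _ _ hw
  have hψneg {w : ℝ} (hw : ¬ 0 < w) : ψ w = 0 := Set.piecewise_eq_of_notMem _ _ _ hw
  have hψeq {w : ℝ} (hw : 0 ≤ w) : φ w / w = ψ w := by
    rcases hw.eq_or_lt with h | h
    · rw [hψneg h.not_lt, ← h, div_zero]
    · exact (hψpos h).symm
  have hφL0 : 0 ≤ L := by
    have h1 := hφ_ratio_nonneg 1 one_pos
    rw [div_one] at h1
    exact h1.trans (le_of_deriv_nonneg_of_tendsto hφ_diff hφ_incr hφ_lim one_pos)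
  have hψm : Measurable ψ := by
    refine ContinuousOn.measurable_piecewise (fun w hw => ?_) continuousOn_const measurableSet_Ioi
    exact ((hφ_diff w hw).continuousAt.div continuousAt_id (ne_of_gt hw)).continuousWithinAt
  have hψd (w : ℝ) (hw : w > 0) : HasDerivAt ψ ((deriv φ w * w - φ w * 1) / w ^ 2) w := by
    refine ((hφ_diff w hw).hasDerivAt.div (hasDerivAt_id w) hw.ne').congr_of_eventuallyEq ?_
    filter_upwards [Ioi_mem_nhds hw] with x hx
    exact hψpos hx
  have hψ0 (w : ℝ) : 0 ≤ ψ w := by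
    by_cases hw : 0 < w
    · exact hψpos hw ▸ hφ_ratio_nonneg w hw
    · exact (hψneg hw).ge
  have hψv (w : ℝ) : ψ w ≤ v := by
    by_cases hw : 0 < w
    · exact hψpos hw ▸ hφ_ratio_le w hw
    · exact (hψneg hw).le.trans hv0
  have hψd' (w : ℝ) (hw : w > 0) : -(ψ w / w) ≤ (deriv φ w * w - φ w * 1) / w ^ 2 := by
    have h1 : -(ψ w / w) = (0 * w - φ w * 1) / w ^ 2 := by
      rw [hψpos hw]
      field_simp
      ring
    rw [h1]
    have := hφ_incr w hw
    gcongr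
  have hψL (w : ℝ) : w * ψ w ≤ L := by
    by_cases hw : 0 < w
    · rw [hψpos hw, mul_div_cancel₀ _ hw.ne']
      exact le_of_deriv_nonneg_of_tendsto hφ_diff hφ_incr hφ_lim hw
    · rw [hψneg hw, mul_zero]
      exact hφL0
  -- transfer to the coordinates `Fin p ⊕ Fin n`
  set R : (Fin p ⊕ Fin n → ℝ) → ℝ :=
    diagForm (Sum.elim θ 0) (Sum.elim (fun i => σ ^ 2 * d i) fun _ => σ ^ 2) with hR
  set κ := (∏ i, (d i) ^ (-(1 : ℝ) / 2)) * σ ^ (-(p : ℝ) - n) with hκ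
  have hκ0 : 0 < κ := mul_pos (prod_pos fun i _ => Real.rpow_pos_of_pos (hd_pos i) _)
    (Real.rpow_pos_of_pos hσ _)
  have he := volume_measurePreserving_sumPiEquivProdPi (fun _ : Fin p ⊕ Fin n => ℝ)
  set e := MeasurableEquiv.sumPiEquivProdPi (fun _ : Fin p ⊕ Fin n => ℝ) with hedef
  have he1 (y) (i : Fin p) : (e y).1 i = y (Sum.inl i) := rfl
  have he2 (y) (k : Fin n) : (e y).2 k = y (Sum.inr k) := rfl
  have hdense (y) : dens (e y) = κ * f (R y) := by
    rw [hdens]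
    simp only [he1, he2, hR, diagForm, Fintype.sum_sum_type, Sum.elim_inl, Sum.elim_inr,
      Pi.zero_apply, sub_zero]
    congr 2
    rw [add_div, sum_div, sum_div]
    congr 1
    exact sum_congr rfl fun i _ => by rw [div_div, mul_comm]
  have hW (y : Fin p ⊕ Fin n → ℝ) : 0 ≤ weightedSq c d y / residualSq (Fin p) y :=
    div_nonneg (weightedSq_nonneg hc_pos hd_pos y) (residualSq_nonneg y)
  have heste (y) (i : Fin p) : est (e y) i =
      (1 - ψ (weightedSq c d y / residualSq (Fin p) y) / c i) * y (Sum.inl i) := by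
    rw [← hψeq (hW y), hest]
    rfl
  have hf1 : Integrable fun y => f (R y) := by
    have h1 : Integrable dens := integrable_of_integral_eq_one hnorm
    rw [← he.integrable_comp_emb e.measurableEmbedding] at h1
    refine (h1.const_mul κ⁻¹).congr (ae_of_all _ fun y => ?_)
    simp only [Function.comp_apply, hdense]
    field_simp
  have hf2 : Integrable fun y => (∑ i, (y (Sum.inl i) - θ i) ^ 2) * f (R y) := by
    rw [← he.integrable_comp_emb e.measurableEmbedding] at h_int_ls
    refine (h_int_ls.const_mul (σ ^ 2 * κ⁻¹)).congr (ae_of_all _ fun y => ?_)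
    simp only [Function.comp_apply, hdense, he1]
    field_simp
  have hn' : Nonempty (Fin n) := ⟨⟨0, hn⟩⟩
  have hp' : Nontrivial (Fin p) := ⟨_, _, hfl⟩
  have hmain := integral_shrinkage_loss_le hc_pos hd_pos hM hψd hψd' hψm hψ0 hψv hψL hbound
    hf_meas hf_nonneg θ hσ hR hf1 hf2
  rw [← he.integral_comp e.measurableEmbedding, ← he.integral_comp e.measurableEmbedding]
  have hscale (T : (Fin p ⊕ Fin n → ℝ) → ℝ) :
      ∫ y, T y / σ ^ 2 * (κ * f (R y)) = κ / σ ^ 2 * ∫ y, T y * f (R y) := by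
    rw [← integral_const_mul]
    congr 1
    funext y
    ring
  simp only [hdense, heste, he1]
  rw [hscale, hscale]
  exact mul_le_mul_of_nonneg_left hmain (by positivity)
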